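/- arXiv:1701.07691 — 2 statements merged into one kernel-verified Lean document; each statement's English description precedes it below -/
import Mathlib

section
/- Let d ≥ 1, s > 0, E ⊆ ℝ^d be a non-degenerate parallelepiped and let f be a smooth E-periodic function on ℝ^d. Then the following are equivalent: (i) for every h > 0 there exists a constant C > 0 such that ‖∂^β f‖_{L^∞(ℝ^d)} ≤ C h^{|β|} (β!)^s for every multi-index β; (ii) for every r > 0 there exists a constant C > 0 such that |c(f,α)| ≤ C e^{-r|α|^{1/s}} for every α ∈ Λ'_E. -/
open MeasureTheory Filter
open scoped BigOperators InnerProductSpace Topology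

noncomputable section

abbrev Euc (d : ℕ) := EuclideanSpace ℝ (Fin d)

/-- The lattice point `∑ i, j i • e i` associated with `j : ℤ^d`. -/
def latPt {d : ℕ} (e : Fin d → Euc d) (j : Fin d → ℤ) : Euc d :=
  ∑ i, (j i : ℝ) • e i

/-- The (closed) parallelepiped spanned by `e`. -/
def paraSet {d : ℕ} (e : Fin d → Euc d) : Set (Euc d) :=
  (fun t : Fin d → ℝ => ∑ i, t i • e i) '' (Set.univ.pi fun _ => Set.Icc (0:ℝ) 1)

/-- Fourier coefficient `c(f, ξ) = |E|⁻¹ ∫_E f(x) e^{-i⟨x,ξ⟩} dx`. -/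
def fourCoeff {d : ℕ} (e : Fin d → Euc d) (f : Euc d → ℂ) (ξ : Euc d) : ℂ :=
  (((volume (paraSet e)).toReal : ℂ))⁻¹ *
    ∫ x in paraSet e, f x * Complex.exp (-(Complex.I) * (⟪x, ξ⟫_ℝ : ℂ))

/-- Iterated partial derivatives along a list of coordinate directions. -/
def pdSeq {d : ℕ} : List (Fin d) → (Euc d → ℂ) → (Euc d → ℂ)
  | [], f => f
  | (i :: L), f => pdSeq L (fun x => fderiv ℝ f x (EuclideanSpace.single i 1))

/-- The canonical list of directions attached to a multi-index `β`. -/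
def mIdxL {d : ℕ} (β : Fin d → ℕ) : List (Fin d) :=
  (List.finRange d).flatMap fun i => List.replicate (β i) i

/-- The multi-index partial derivative `∂^β f`. -/
def pD {d : ℕ} (β : Fin d → ℕ) (f : Euc d → ℂ) : Euc d → ℂ := pdSeq (mIdxL β) f

/-- Fourier transform, normalized as `(2π)^{-d/2} ∫ f(x) e^{-i⟨x,ξ⟩} dx`. -/
def FT {d : ℕ} (f : Euc d → ℂ) (ξ : Euc d) : ℂ :=
  (((2 * Real.pi) ^ (-(d:ℝ)/2) : ℝ) : ℂ) *
    ∫ x, f x * Complex.exp (-(Complex.I) * (⟪x, ξ⟫_ℝ : ℂ))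

/-- Short-time Fourier transform with window `φ`. -/
def STFT {d : ℕ} (φ f : Euc d → ℂ) (x ξ : Euc d) : ℂ :=
  (((2 * Real.pi) ^ (-(d:ℝ)/2) : ℝ) : ℂ) *
    ∫ y, f y * (starRingEnd ℂ) (φ (y - x)) * Complex.exp (-(Complex.I) * (⟪y, ξ⟫_ℝ : ℂ))

/-- The linear equivalence `t ↦ ∑ i, t i • e i` attached to a basis `e`. -/
def paraEquiv {d : ℕ} (e : Fin d → Euc d) (he : LinearIndependent ℝ e) :
    (Fin d → ℝ) ≃L[ℝ] Euc d :=
  (basisOfLinearIndependentOfCardEqFinrank' e he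
    (by simp)).equivFun.symm.toContinuousLinearEquiv

lemma paraEquiv_apply {d : ℕ} (e : Fin d → Euc d) (he : LinearIndependent ℝ e)
    (t : Fin d → ℝ) : paraEquiv e he t = ∑ i, t i • e i := by
  simp [paraEquiv, Module.Basis.equivFun_symm_apply]

lemma latPt_eq_paraEquiv {d : ℕ} (e : Fin d → Euc d) (he : LinearIndependent ℝ e)
    (j : Fin d → ℤ) : latPt e j = paraEquiv e he (fun i => (j i : ℝ)) := by
  rw [paraEquiv_apply, latPt]

lemma inner_paraEquiv_latPt {d : ℕ} (e e' : Fin d → Euc d) (he : LinearIndependent ℝ e)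
    (hdual : ∀ j k, ⟪e j, e' k⟫_ℝ = if j = k then 2 * Real.pi else 0)
    (t : Fin d → ℝ) (ι : Fin d → ℤ) :
    ⟪paraEquiv e he t, latPt e' ι⟫_ℝ = 2 * Real.pi * ∑ i, t i * ι i := by
  simp only [paraEquiv_apply, latPt, sum_inner, inner_sum, real_inner_smul_left,
    real_inner_smul_right, hdual, Finset.mul_sum]
  refine Finset.sum_congr rfl fun i _ => ?_
  rw [Finset.sum_eq_single i (fun j _ hj => by simp [hj]) (by simp)]
  simp
  ring

lemma paraSet_eq_image {d : ℕ} (e : Fin d → Euc d) (he : LinearIndependent ℝ e) :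
    paraSet e = paraEquiv e he '' Set.Icc 0 1 := by
  have h : (fun t : Fin d → ℝ => ∑ i, t i • e i) = paraEquiv e he :=
    funext fun t => (paraEquiv_apply e he t).symm
  rw [paraSet, h, ← Set.pi_univ_Icc]
  rfl

lemma fourCoeff_eq_integral_cube {d : ℕ} (e : Fin d → Euc d) (he : LinearIndependent ℝ e)
    (f : Euc d → ℂ) (ξ : Euc d) :
    fourCoeff e f ξ = ∫ t in Set.Icc (0 : Fin d → ℝ) 1, f (paraEquiv e he t) *
      Complex.exp (-Complex.I * (⟪paraEquiv e he t, ξ⟫_ℝ : ℂ)) := by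
  set T := paraEquiv e he with hT
  have hemb : MeasurableEmbedding T := T.toHomeomorph.measurableEmbedding
  have : (Measure.map T volume).IsAddHaarMeasure := T.isAddHaarMeasure_map volume
  set c := (volume : Measure (Euc d)).addHaarScalarFactor (Measure.map T volume) with hc
  have hvol : (volume : Measure (Euc d)) = c • Measure.map T volume :=
    Measure.isAddLeftInvariant_eq_smul _ _
  have hc0 : c ≠ 0 := (Measure.addHaarScalarFactor_pos_of_isAddHaarMeasure _ _).ne'
  have hpre : T ⁻¹' (T '' Set.Icc 0 1) = Set.Icc 0 1 := Set.preimage_image_eq _ T.injective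
  have hE : (volume (paraSet e)).toReal = c := by
    rw [paraSet_eq_image e he, hvol, Measure.smul_apply, hemb.map_apply, hpre,
      Real.volume_Icc_pi]
    simp [ENNReal.smul_def]
  rw [fourCoeff, hE, paraSet_eq_image e he]
  conv_lhs => rw [hvol]
  rw [Measure.restrict_smul, integral_smul_nnreal_measure, hemb.setIntegral_map, hpre,
    NNReal.smul_def, Complex.real_smul, inv_mul_cancel_left₀ (by exact_mod_cast hc0)]

lemma integral_cube_fderiv_eq_zero {d : ℕ} (e : Fin d → Euc d) (he : LinearIndependent ℝ e)
    (u : Euc d → ℂ) (hu : ContDiff ℝ 1 u)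
    (hper : ∀ (x : Euc d) (j : Fin d → ℤ), u (x + latPt e j) = u x) (v : Euc d) :
    ∫ t in Set.Icc (0 : Fin d → ℝ) 1, fderiv ℝ u (paraEquiv e he t) v = 0 := by
  set T := paraEquiv e he with hT
  cases d with
  | zero => simp [Subsingleton.elim v 0]
  | succ n =>
    set w := T.symm v with hw
    have hderiv (t : Fin (n + 1) → ℝ) : HasFDerivAt (fun t => u (T t))
        ((fderiv ℝ u (T t)).comp (T : (Fin (n + 1) → ℝ) →L[ℝ] Euc (n + 1))) t :=
      ((hu.differentiable one_ne_zero) (T t)).hasFDerivAt.comp t T.hasFDerivAt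
    have hsum (t : Fin (n + 1) → ℝ) : ∑ i, (w i • (fderiv ℝ u (T t)).comp
        (T : (Fin (n + 1) → ℝ) →L[ℝ] Euc (n + 1))) (Pi.single i 1) = fderiv ℝ u (T t) v := by
      have : v = ∑ i, w i • T (Pi.single i 1) := by
        rw [← T.apply_symm_apply v, ← hw]
        conv_lhs => rw [pi_eq_sum_univ' w]
        simp
      conv_rhs => rw [this]
      simp
    have hcont : Continuous fun t => fderiv ℝ u (T t) v :=
      ((hu.continuous_fderiv one_ne_zero).comp T.continuous).clm_apply continuous_const
    have key := integral_divergence_of_hasFDerivAt_off_countable' (0 : Fin (n + 1) → ℝ) 1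
      zero_le_one (fun i t => w i • u (T t)) (fun i t => w i • (fderiv ℝ u (T t)).comp
        (T : (Fin (n + 1) → ℝ) →L[ℝ] Euc (n + 1))) ∅ Set.countable_empty
      (fun i => ((hu.continuous.comp T.continuous).const_smul (w i)).continuousOn)
      (fun t _ i => (hderiv t).const_smul (w i))
      (by simp only [hsum]; exact hcont.continuousOn.integrableOn_compact isCompact_Icc)
    simp only [hsum] at key
    rw [key]
    refine Finset.sum_eq_zero fun i _ => ?_
    rw [sub_eq_zero]
    congr 1
    funext y
    congr 1
    rw [← hper (T (i.insertNth ((0 : Fin (n + 1) → ℝ) i) y)) (Pi.single i 1),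
      latPt_eq_paraEquiv e he, ← hT, ← map_add]
    congr 2
    refine (Fin.forall_iff_succAbove (p := i)).2 ?_ |> funext
    simp

lemma exp_inner_periodic {d : ℕ} (e e' : Fin d → Euc d) (he : LinearIndependent ℝ e)
    (hdual : ∀ j k, ⟪e j, e' k⟫_ℝ = if j = k then 2 * Real.pi else 0)
    (ι : Fin d → ℤ) (x : Euc d) (j : Fin d → ℤ) :
    Complex.exp (-Complex.I * (⟪x + latPt e j, latPt e' ι⟫_ℝ : ℂ)) =
      Complex.exp (-Complex.I * (⟪x, latPt e' ι⟫_ℝ : ℂ)) := by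
  rw [inner_add_left, latPt_eq_paraEquiv e he, inner_paraEquiv_latPt e e' he hdual,
    Complex.exp_eq_exp_iff_exists_int]
  refine ⟨-∑ i, j i * ι i, ?_⟩
  push_cast
  ring

lemma fourCoeff_fderiv {d : ℕ} (e e' : Fin d → Euc d) (he : LinearIndependent ℝ e)
    (hdual : ∀ j k, ⟪e j, e' k⟫_ℝ = if j = k then 2 * Real.pi else 0)
    (f : Euc d → ℂ) (hf : ContDiff ℝ 1 f)
    (hper : ∀ (x : Euc d) (j : Fin d → ℤ), f (x + latPt e j) = f x)
    (ι : Fin d → ℤ) (v : Euc d) :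
    fourCoeff e (fun x => fderiv ℝ f x v) (latPt e' ι) =
      Complex.I * (⟪v, latPt e' ι⟫_ℝ : ℂ) * fourCoeff e f (latPt e' ι) := by
  set ξ := latPt e' ι with hξ
  set E : Euc d → ℂ := fun x => Complex.exp (-Complex.I * (⟪x, ξ⟫_ℝ : ℂ)) with hE
  have hEd (x : Euc d) : HasFDerivAt E (E x • (-Complex.I) •
      (Complex.ofRealCLM.comp (innerSL ℝ ξ))) x := by
    have h1 : HasFDerivAt (fun x : Euc d => ((⟪x, ξ⟫_ℝ : ℝ) : ℂ))
        (Complex.ofRealCLM.comp (innerSL ℝ ξ)) x := by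
      simp only [real_inner_comm ξ]
      exact (Complex.ofRealCLM.comp (innerSL ℝ ξ)).hasFDerivAt
    exact (h1.const_mul (-Complex.I)).cexp
  have hEc : ContDiff ℝ 1 E := by
    have h1 : ContDiff ℝ 1 (fun x : Euc d => ((⟪x, ξ⟫_ℝ : ℝ) : ℂ)) := by
      simp only [real_inner_comm ξ]
      exact (Complex.ofRealCLM.comp (innerSL ℝ ξ)).contDiff
    exact (contDiff_const.mul h1).cexp
  have h0 := integral_cube_fderiv_eq_zero e he (fun x => f x * E x) (hf.mul hEc)
    (fun x j => by simp only [hper, hE, hξ, exp_inner_periodic e e' he hdual]) v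
  have hfd (x : Euc d) : fderiv ℝ (fun x => f x * E x) x v =
      fderiv ℝ f x v * E x - Complex.I * (⟪v, ξ⟫_ℝ : ℂ) * (f x * E x) := by
    have h1 := ((hf.differentiable one_ne_zero) x).hasFDerivAt.mul (hEd x)
    have h2 : f * E = fun x => f x * E x := rfl
    rw [← h2, h1.fderiv, real_inner_comm]
    simp
    ring
  have hT : Continuous (paraEquiv e he) := (paraEquiv e he).continuous
  simp only [hfd] at h0
  rw [integral_sub, integral_const_mul, sub_eq_zero] at h0
  · rw [fourCoeff_eq_integral_cube e he, fourCoeff_eq_integral_cube e he]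
    exact h0
  · refine Continuous.integrableOn_Icc ?_
    exact (((hf.continuous_fderiv one_ne_zero).comp hT).clm_apply continuous_const).mul
      (hEc.continuous.comp hT)
  · refine Continuous.integrableOn_Icc ?_
    exact continuous_const.mul ((hf.continuous.comp hT).mul (hEc.continuous.comp hT))

lemma contDiff_pdSeq {d : ℕ} (L : List (Fin d)) {f : Euc d → ℂ}
    (hf : ContDiff ℝ (⊤ : ℕ∞) f) : ContDiff ℝ (⊤ : ℕ∞) (pdSeq L f) := by
  induction L generalizing f with
  | nil => exact hf
  | cons i L ih => exact ih ((hf.fderiv_right (by simp)).clm_apply contDiff_const)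

lemma fderiv_periodic {d : ℕ} {e : Fin d → Euc d} {f : Euc d → ℂ}
    (hper : ∀ (x : Euc d) (j : Fin d → ℤ), f (x + latPt e j) = f x)
    (x : Euc d) (j : Fin d → ℤ) : fderiv ℝ f (x + latPt e j) = fderiv ℝ f x := by
  rw [← fderiv_comp_add_right]
  simp only [hper]

lemma pdSeq_periodic {d : ℕ} {e : Fin d → Euc d} (L : List (Fin d)) {f : Euc d → ℂ}
    (hper : ∀ (x : Euc d) (j : Fin d → ℤ), f (x + latPt e j) = f x)
    (x : Euc d) (j : Fin d → ℤ) : pdSeq L f (x + latPt e j) = pdSeq L f x := by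
  induction L generalizing f with
  | nil => exact hper x j
  | cons i L ih => exact ih fun x j => by rw [fderiv_periodic hper]

lemma fourCoeff_pdSeq {d : ℕ} (e e' : Fin d → Euc d) (he : LinearIndependent ℝ e)
    (hdual : ∀ j k, ⟪e j, e' k⟫_ℝ = if j = k then 2 * Real.pi else 0)
    (L : List (Fin d)) (f : Euc d → ℂ) (hf : ContDiff ℝ (⊤ : ℕ∞) f)
    (hper : ∀ (x : Euc d) (j : Fin d → ℤ), f (x + latPt e j) = f x) (ι : Fin d → ℤ) :
    fourCoeff e (pdSeq L f) (latPt e' ι) =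
      (L.map fun i => Complex.I * (latPt e' ι i : ℂ)).prod * fourCoeff e f (latPt e' ι) := by
  induction L generalizing f with
  | nil => simp [pdSeq]
  | cons i L ih =>
    rw [pdSeq, ih _ ((hf.fderiv_right (by simp)).clm_apply contDiff_const)
      (fun x j => by rw [fderiv_periodic hper]),
      fourCoeff_fderiv e e' he hdual f (hf.of_le (by exact_mod_cast le_top)) hper,
      EuclideanSpace.inner_single_left, List.map_cons, List.prod_cons]
    simp
    ring

lemma prod_map_mIdxL {d : ℕ} {M : Type*} [CommMonoid M] (β : Fin d → ℕ) (g : Fin d → M) :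
    ((mIdxL β).map g).prod = ∏ i, g i ^ β i := by
  rw [mIdxL, List.map_flatMap, Fin.prod_univ_def]
  induction List.finRange d with
  | nil => simp
  | cons i L ih =>
    rw [List.flatMap_cons, List.prod_append, ih]
    simp

lemma norm_fourCoeff_pD {d : ℕ} (e e' : Fin d → Euc d) (he : LinearIndependent ℝ e)
    (hdual : ∀ j k, ⟪e j, e' k⟫_ℝ = if j = k then 2 * Real.pi else 0)
    (f : Euc d → ℂ) (hf : ContDiff ℝ (⊤ : ℕ∞) f)
    (hper : ∀ (x : Euc d) (j : Fin d → ℤ), f (x + latPt e j) = f x)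
    (β : Fin d → ℕ) (ι : Fin d → ℤ) :
    ‖fourCoeff e (pD β f) (latPt e' ι)‖ =
      (∏ i, |latPt e' ι i| ^ β i) * ‖fourCoeff e f (latPt e' ι)‖ := by
  rw [pD, fourCoeff_pdSeq e e' he hdual _ f hf hper, prod_map_mIdxL]
  simp

lemma norm_fourCoeff_le {d : ℕ} (e : Fin d → Euc d) (he : LinearIndependent ℝ e)
    {g : Euc d → ℂ} {M : ℝ} (hM : ∀ x, ‖g x‖ ≤ M) (ξ : Euc d) : ‖fourCoeff e g ξ‖ ≤ M := by
  rw [fourCoeff_eq_integral_cube e he]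
  have hvol : volume (Set.Icc (0 : Fin d → ℝ) 1) = 1 := by simp [Real.volume_Icc_pi]
  refine (norm_setIntegral_le_of_norm_le_const (C := M) (by simp [hvol]) fun t _ => ?_).trans ?_
  · rw [norm_mul, Complex.norm_exp]
    simpa using hM _
  · simp [measureReal_def, hvol]

lemma exists_torus_lift {d : ℕ} (G : (Fin d → ℝ) → ℂ) (hG : Continuous G)
    (hper : ∀ (t : Fin d → ℝ) (j : Fin d → ℤ), G (t + fun i => (j i : ℝ)) = G t) :
    ∃ F : C(UnitAddTorus (Fin d), ℂ), ∀ t : Fin d → ℝ, F (fun i => (t i : UnitAddCircle)) = G t := by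
  have hq : Topology.IsQuotientMap
      (Pi.map fun _ : Fin d => ((↑) : ℝ → UnitAddCircle)) :=
    (IsOpenQuotientMap.piMap fun _ => QuotientAddGroup.isOpenQuotientMap_mk).isQuotientMap
  have hcompat (a b : Fin d → ℝ) (hab : Pi.map (fun _ : Fin d => ((↑) : ℝ → UnitAddCircle)) a =
      Pi.map (fun _ : Fin d => ((↑) : ℝ → UnitAddCircle)) b) : G a = G b := by
    have h1 (i : Fin d) : ∃ n : ℤ, a i = b i + n := by
      have h2 : ((a i : ℝ) : UnitAddCircle) = (b i : ℝ) := congrFun hab i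
      obtain ⟨n, hn⟩ := AddSubgroup.mem_zmultiples_iff.1 (QuotientAddGroup.eq.1 h2)
      exact ⟨-n, by simp at hn; push_cast; linarith⟩
    choose n hn using h1
    rw [← hper b n]
    exact congrArg G (funext hn)
  let G' : C(Fin d → ℝ, ℂ) := ⟨G, hG⟩
  let p : C(Fin d → ℝ, UnitAddTorus (Fin d)) :=
    ⟨Pi.map fun _ : Fin d => ((↑) : ℝ → UnitAddCircle), hq.continuous⟩
  have hp : Topology.IsQuotientMap p := hq
  refine ⟨hp.lift G' hcompat, fun t => ?_⟩
  exact congrArg (fun φ : C(Fin d → ℝ, ℂ) => φ t) (hp.lift_comp G' hcompat)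

lemma norm_le_tsum_fourCoeff {d : ℕ} (e e' : Fin d → Euc d) (he : LinearIndependent ℝ e)
    (hdual : ∀ j k, ⟪e j, e' k⟫_ℝ = if j = k then 2 * Real.pi else 0)
    (g : Euc d → ℂ) (hg : Continuous g)
    (hper : ∀ (x : Euc d) (j : Fin d → ℤ), g (x + latPt e j) = g x)
    (hsum : Summable fun ι => ‖fourCoeff e g (latPt e' ι)‖) (x : Euc d) :
    ‖g x‖ ≤ ∑' ι, ‖fourCoeff e g (latPt e' ι)‖ := by
  set T := paraEquiv e he with hT
  obtain ⟨F, hF⟩ := exists_torus_lift (fun t => g (T t)) (hg.comp T.continuous)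
    (fun t j => by rw [map_add, hT, ← latPt_eq_paraEquiv e he, hper])
  have hcoeff (ι : Fin d → ℤ) :
      UnitAddTorus.mFourierCoeff F ι = fourCoeff e g (latPt e' ι) := by
    rw [UnitAddTorus.mFourierCoeff_eq_integral F ι 0, fourCoeff_eq_integral_cube e he, volume_pi,
      ← setIntegral_congr_set Measure.univ_pi_Ioc_ae_eq_Icc]
    have hset : {x : Fin d → ℝ | ∀ i, x i ∈ Set.Ioc ((0 : Fin d → ℝ) i) ((0 : Fin d → ℝ) i + 1)} =
        Set.univ.pi fun i => Set.Ioc ((0 : Fin d → ℝ) i) ((1 : Fin d → ℝ) i) := by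
      ext x; simp
    rw [hset]
    congr 1
    funext t
    rw [hF, ← hT, hT, inner_paraEquiv_latPt e e' he hdual, smul_eq_mul, mul_comm]
    congr 1
    simp only [UnitAddTorus.mFourier, ContinuousMap.coe_mk, fourier_coe_apply, ← Complex.exp_sum]
    congr 1
    push_cast
    rw [Finset.mul_sum, Finset.mul_sum]
    refine Finset.sum_congr rfl fun i _ => ?_
    simp
    ring
  have hsum' : Summable (UnitAddTorus.mFourierCoeff F) := by
    refine Summable.of_norm ?_
    simpa only [hcoeff] using hsum
  have hs := UnitAddTorus.hasSum_mFourier_series_apply_of_summable hsum'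
    (fun i => (T.symm x i : UnitAddCircle))
  rw [hF, T.apply_symm_apply] at hs
  refine hs.norm_le_of_bounded hsum.hasSum fun ι => ?_
  rw [hcoeff, norm_smul]
  refine mul_le_of_le_one_right (norm_nonneg _) ?_
  exact (ContinuousMap.norm_coe_le_norm _ _).trans UnitAddTorus.mFourier_norm.le

lemma le_exp_of_forall_pow_mul_le {s h a A C : ℝ} (hs : 0 < s) (hh : 0 < h) (ha : 0 ≤ a)
    (hA : 0 ≤ A) (hC : 0 ≤ C)
    (H : ∀ n : ℕ, a ^ n * A ≤ C * h ^ n * (n.factorial : ℝ) ^ s) :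
    A ≤ 2 ^ s * C * Real.exp (-(s / 2) * (a / h) ^ (1 / s)) := by
  set y := (a / h) ^ (1 / s) with hy
  have hy0 : 0 ≤ y := by positivity
  have hys : y ^ s = a / h := by
    rw [hy, ← Real.rpow_mul (by positivity), one_div_mul_cancel hs.ne', Real.rpow_one]
  set B := A ^ (1 / s) with hB
  have hB0 : 0 ≤ B := by positivity
  have hBs : B ^ s = A := by
    rw [hB, ← Real.rpow_mul hA, one_div_mul_cancel hs.ne', Real.rpow_one]
  set D := C ^ (1 / s) with hD
  have hD0 : 0 ≤ D := by positivity
  have hDs : D ^ s = C := by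
    rw [hD, ← Real.rpow_mul hC, one_div_mul_cancel hs.ne', Real.rpow_one]
  have h1 (n : ℕ) : y ^ n * B ≤ D * n.factorial := by
    rw [← Real.rpow_le_rpow_iff (by positivity) (by positivity) hs,
      Real.mul_rpow (by positivity) hB0, Real.mul_rpow hD0 (by positivity), hBs, hDs,
      ← Real.rpow_natCast_mul hy0, mul_comm (n : ℝ) s, Real.rpow_mul_natCast hy0, hys, div_pow,
      div_mul_eq_mul_div, div_le_iff₀ (by positivity)]
    linarith [H n]
  have h2 : HasSum (fun n : ℕ => (y / 2) ^ n / n.factorial * B) (Real.exp (y / 2) * B) := by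
    have := NormedSpace.expSeries_div_hasSum_exp (𝔸 := ℝ) (y / 2)
    rw [← Real.exp_eq_exp_ℝ] at this
    exact this.mul_right B
  have h3 : Real.exp (y / 2) * B ≤ D * 2 := by
    refine hasSum_le (fun n => ?_) h2 (hasSum_geometric_two.mul_left D)
    rw [div_mul_eq_mul_div, div_le_iff₀ (by positivity), div_pow, div_mul_eq_mul_div,
      div_le_iff₀ (by positivity)]
    calc y ^ n * B ≤ D * n.factorial := h1 n
      _ = D * (1 / 2) ^ n * n.factorial * 2 ^ n := by
        have : ((1 : ℝ) / 2) ^ n * 2 ^ n = 1 := by rw [← mul_pow]; norm_num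
        linear_combination (-(D * n.factorial)) * this
  have h4 := Real.rpow_le_rpow (by positivity) h3 hs.le
  rw [Real.mul_rpow (by positivity) hB0, Real.mul_rpow hD0 (by positivity), hBs, hDs,
    ← Real.exp_mul] at h4
  rw [show -(s / 2) * y = -(y / 2 * s) by ring, Real.exp_neg, ← div_eq_mul_inv,
    le_div_iff₀ (Real.exp_pos _)]
  linarith

lemma pow_le_factorial_rpow_mul_exp {s h a : ℝ} (hs : 0 < s) (hh : 0 < h) (ha : 0 ≤ a) (n : ℕ) :
    a ^ n ≤ h ^ n * (n.factorial : ℝ) ^ s * Real.exp (s * (a / h) ^ (1 / s)) := by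
  set y := (a / h) ^ (1 / s) with hy
  have hy0 : 0 ≤ y := by positivity
  have hys : y ^ s = a / h := by
    rw [hy, ← Real.rpow_mul (by positivity), one_div_mul_cancel hs.ne', Real.rpow_one]
  have h1 : y ^ n ≤ n.factorial * Real.exp y := by
    have := Real.pow_div_factorial_le_exp y hy0 n
    rw [div_le_iff₀ (by positivity)] at this
    linarith
  have h2 := Real.rpow_le_rpow (by positivity) h1 hs.le
  rw [Real.mul_rpow (by positivity) (by positivity), ← Real.rpow_natCast_mul hy0,
    mul_comm (n : ℝ) s, Real.rpow_mul_natCast hy0, hys, div_pow, div_le_iff₀ (by positivity),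
    ← Real.exp_mul] at h2
  rw [mul_comm s y]
  linarith

lemma summable_pi_prod {ι κ : Type*} [Fintype ι] {g : κ → ℝ} (hg : ∀ k, 0 ≤ g k)
    (hs : Summable g) : Summable fun x : ι → κ => ∏ i, g (x i) := by
  classical
  refine summable_of_sum_le (c := ∏ _i : ι, ∑' k, g k)
    (fun x => Finset.prod_nonneg fun i _ => hg _) fun S => ?_
  have hsub : S ⊆ Fintype.piFinset fun i : ι => S.image fun x => x i := fun x hx =>
    Fintype.mem_piFinset.2 fun i => Finset.mem_image_of_mem (fun x : ι → κ => x i) hx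
  refine (Finset.sum_le_sum_of_subset_of_nonneg hsub
    fun x _ _ => Finset.prod_nonneg fun i _ => hg _).trans ?_
  rw [← Finset.prod_univ_sum]
  exact Finset.prod_le_prod (fun i _ => Finset.sum_nonneg fun k _ => hg k)
    fun i _ => hs.sum_le_tsum _ fun k _ => hg k

lemma summable_int_exp_neg_mul_abs_rpow {b p : ℝ} (hb : 0 < b) (hp : 0 < p) :
    Summable fun n : ℤ => Real.exp (-b * |(n : ℝ)| ^ p) := by
  have hnat : Summable fun n : ℕ => Real.exp (-b * (n : ℝ) ^ p) := by
    refine summable_of_isBigO_nat (Real.summable_nat_rpow.2 (by norm_num : (-2 : ℝ) < -1)) ?_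
    have h1 := ((isLittleO_exp_neg_mul_rpow_atTop hb (-2 / p)).comp_tendsto
      ((tendsto_rpow_atTop hp).comp tendsto_natCast_atTop_atTop)).isBigO
    refine h1.congr (fun n => rfl) fun n => ?_
    simp only [Function.comp]
    rw [← Real.rpow_mul (Nat.cast_nonneg n), mul_div_cancel₀ _ hp.ne']
  exact Summable.of_nat_of_neg (by simpa using hnat) (by simpa using hnat)

lemma summable_exp_neg_norm_latPt_rpow {d : ℕ} (e e' : Fin d → Euc d)
    (hdual : ∀ j k, ⟪e j, e' k⟫_ℝ = if j = k then 2 * Real.pi else 0) {p : ℝ} (hp : 0 < p) :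
    Summable fun ι : Fin d → ℤ => Real.exp (-‖latPt e' ι‖ ^ p) := by
  rcases Nat.eq_zero_or_pos d with rfl | hd
  · exact Summable.of_finite
  set M : ℝ := ∑ i, ‖e i‖ + 1 with hM
  have hM0 : 0 < M := by positivity
  have hcoord (ι : Fin d → ℤ) (i : Fin d) : |(ι i : ℝ)| ≤ M * ‖latPt e' ι‖ := by
    have h1 : ⟪e i, latPt e' ι⟫_ℝ = ι i * (2 * Real.pi) := by
      simp [latPt, inner_sum, real_inner_smul_right, hdual]
    have h2 := abs_real_inner_le_norm (e i) (latPt e' ι)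
    rw [h1, abs_mul, abs_of_pos Real.two_pi_pos] at h2
    have h3 : ‖e i‖ ≤ M :=
      (Finset.single_le_sum (f := fun i => ‖e i‖) (fun _ _ => norm_nonneg _)
        (Finset.mem_univ i)).trans (by linarith)
    have h4 := mul_le_mul_of_nonneg_right h3 (norm_nonneg (latPt e' ι))
    nlinarith [Real.pi_gt_three, abs_nonneg (ι i : ℝ)]
  set b : ℝ := 1 / (d * M ^ p) with hb
  have hd' : (0 : ℝ) < d := by exact_mod_cast hd
  have hb0 : 0 < b := by positivity
  refine Summable.of_nonneg_of_le (fun _ => (Real.exp_pos _).le) (fun ι => ?_)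
    (summable_pi_prod (fun _ => (Real.exp_pos _).le) (summable_int_exp_neg_mul_abs_rpow hb0 hp))
  rw [← Real.exp_sum, Real.exp_le_exp, ← Finset.mul_sum, neg_mul, neg_le_neg_iff, hb,
    one_div_mul_eq_div, div_le_iff₀ (by positivity)]
  calc ∑ i, |(ι i : ℝ)| ^ p ≤ ∑ _i : Fin d, (M * ‖latPt e' ι‖) ^ p :=
        Finset.sum_le_sum fun i _ => Real.rpow_le_rpow (abs_nonneg _) (hcoord ι i) hp.le
    _ = ‖latPt e' ι‖ ^ p * (d * M ^ p) := by
        rw [Finset.sum_const, Real.mul_rpow hM0.le (norm_nonneg _)]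
        simp
        ring

lemma exists_norm_le_card_mul_abs {d : ℕ} (hd : 1 ≤ d) (ξ : Euc d) :
    ∃ j, ‖ξ‖ ≤ d * |ξ j| := by
  have : Nonempty (Fin d) := ⟨⟨0, hd⟩⟩
  obtain ⟨j, hj⟩ := Finite.exists_max fun i => |ξ i|
  have hd' : (1 : ℝ) ≤ d := by exact_mod_cast hd
  refine ⟨j, abs_le_of_sq_le_sq' ?_ (by positivity) |>.2⟩
  rw [EuclideanSpace.norm_sq_eq]
  calc ∑ i, ‖ξ i‖ ^ 2 ≤ ∑ _i : Fin d, |ξ j| ^ 2 :=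
        Finset.sum_le_sum fun i _ => pow_le_pow_left₀ (norm_nonneg _) (hj i) 2
    _ = d * |ξ j| ^ 2 := by simp
    _ ≤ (d * |ξ j|) ^ 2 := by
        rw [mul_pow]
        exact mul_le_mul_of_nonneg_right (by nlinarith) (by positivity)

lemma prod_abs_pow_le {d : ℕ} {s h : ℝ} (hs : 0 < s) (hh : 0 < h) (ξ : Euc d)
    (β : Fin d → ℕ) :
    ∏ i, |ξ i| ^ β i ≤ h ^ (∑ i, β i) * ((∏ i, (β i).factorial : ℕ) : ℝ) ^ s *
      Real.exp (s * d * (‖ξ‖ / h) ^ (1 / s)) := by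
  calc ∏ i, |ξ i| ^ β i ≤ ∏ i, (h ^ β i * ((β i).factorial : ℝ) ^ s *
        Real.exp (s * (‖ξ‖ / h) ^ (1 / s))) := by
        refine Finset.prod_le_prod (fun i _ => by positivity) fun i _ => ?_
        refine (pow_le_factorial_rpow_mul_exp hs hh (abs_nonneg _) _).trans ?_
        have : |ξ i| ≤ ‖ξ‖ := by simpa using PiLp.norm_apply_le ξ i
        gcongr
    _ = _ := by
        rw [Finset.prod_mul_distrib, Finset.prod_mul_distrib, Finset.prod_pow_eq_pow_sum,
          Real.finsetProd_rpow _ _ (fun i _ => by positivity), Finset.prod_const,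
          ← Real.exp_nat_mul]
        push_cast
        simp
        left
        ring

/-- A smooth `E`-periodic function satisfies a Beurling–Gevrey-`s` bound (for every
`h > 0`) on all partial derivatives iff its Fourier coefficients decay like `C e^{-r|α|^{1/s}}`
for every `r > 0`. -/
theorem periodic_gevrey_beurling_iff_coeff_decay
    {d : ℕ} (hd : 1 ≤ d) (s : ℝ) (hs : 0 < s)
    (e e' : Fin d → Euc d) (he : LinearIndependent ℝ e)
    (hdual : ∀ j k, ⟪e j, e' k⟫_ℝ = if j = k then 2 * Real.pi else 0)
    (f : Euc d → ℂ) (hf : ContDiff ℝ (⊤ : ℕ∞) f)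
    (hper : ∀ (x : Euc d) (j : Fin d → ℤ), f (x + latPt e j) = f x) :
    (∀ h : ℝ, 0 < h → ∃ C : ℝ, 0 < C ∧ ∀ (β : Fin d → ℕ) (x : Euc d),
        ‖pD β f x‖ ≤ C * h ^ (∑ i, β i) * (((∏ i, (β i).factorial : ℕ) : ℝ)) ^ s)
    ↔
    (∀ r : ℝ, 0 < r → ∃ C : ℝ, 0 < C ∧ ∀ ι : Fin d → ℤ,
        ‖fourCoeff e f (latPt e' ι)‖ ≤ C * Real.exp (-r * ‖latPt e' ι‖ ^ (1/s))) := by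
  constructor
  · intro H r hr
    have hd' : (0 : ℝ) < d := by exact_mod_cast hd
    set h : ℝ := (s / (2 * r)) ^ s / d with hh
    have hh0 : 0 < h := by positivity
    obtain ⟨C, hC, hbound⟩ := H h hh0
    refine ⟨2 ^ s * C, by positivity, fun ι => ?_⟩
    set ξ := latPt e' ι with hξ
    obtain ⟨j, hj⟩ := exists_norm_le_card_mul_abs hd ξ
    refine (le_exp_of_forall_pow_mul_le (a := |ξ j|) hs hh0 (abs_nonneg _) (norm_nonneg _) hC.le
      fun n => ?_).trans ?_
    · have h1 := norm_fourCoeff_le e he (fun x => hbound (Pi.single j n) x) ξ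
      rw [hξ, norm_fourCoeff_pD e e' he hdual f hf hper, ← hξ] at h1
      have h2 : ∏ i, |ξ i| ^ (Pi.single j n : Fin d → ℕ) i = |ξ j| ^ n := by
        rw [Finset.prod_eq_single j (fun i _ hi => by simp [hi]) (by simp)]
        simp
      have h3 : ∏ i, ((Pi.single j n : Fin d → ℕ) i).factorial = n.factorial := by
        rw [Finset.prod_eq_single j (fun i _ hi => by simp [hi]) (by simp)]
        simp
      simpa only [h2, h3, Finset.sum_pi_single', Finset.mem_univ, if_true] using h1
    · have hle : ‖ξ‖ * (2 * r / s) ^ s ≤ |ξ j| / h := by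
        rw [hh, ← inv_div s (2 * r), Real.inv_rpow (by positivity), ← div_eq_mul_inv,
          div_div_eq_mul_div]
        gcongr
        linarith
      have hle' := Real.rpow_le_rpow (by positivity) hle (by positivity : 0 ≤ 1 / s)
      rw [Real.mul_rpow (by positivity) (by positivity), ← Real.rpow_mul (by positivity),
        mul_one_div_cancel hs.ne', Real.rpow_one] at hle'
      refine mul_le_mul_of_nonneg_left (Real.exp_le_exp.2 ?_) (by positivity)
      calc -(s / 2) * (|ξ j| / h) ^ (1 / s) ≤ -(s / 2) * (‖ξ‖ ^ (1 / s) * (2 * r / s)) :=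
            mul_le_mul_of_nonpos_left hle' (by linarith)
        _ = -r * ‖ξ‖ ^ (1 / s) := by field_simp
  · intro H h hh
    obtain ⟨C, hC, hbound⟩ := H (s * d * (1 / h) ^ (1 / s) + 1) (by positivity)
    have hS := summable_exp_neg_norm_latPt_rpow e e' hdual (p := 1 / s) (by positivity)
    set S := ∑' ι : Fin d → ℤ, Real.exp (-‖latPt e' ι‖ ^ (1 / s)) with hSdef
    have hS0 : 0 ≤ S := tsum_nonneg fun _ => (Real.exp_pos _).le
    refine ⟨C * (S + 1), by positivity, fun β x => ?_⟩
    set Q := h ^ (∑ i, β i) * ((∏ i, (β i).factorial : ℕ) : ℝ) ^ s with hQ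
    have hQ0 : 0 ≤ Q := by positivity
    have hterm (ι : Fin d → ℤ) : ‖fourCoeff e (pD β f) (latPt e' ι)‖ ≤
        Q * C * Real.exp (-‖latPt e' ι‖ ^ (1 / s)) := by
      rw [norm_fourCoeff_pD e e' he hdual f hf hper]
      refine (mul_le_mul (prod_abs_pow_le hs hh (latPt e' ι) β) (hbound ι) (norm_nonneg _)
        (by positivity)).trans (le_of_eq ?_)
      rw [← hQ, mul_mul_mul_comm, ← Real.exp_add, div_eq_mul_one_div,
        Real.mul_rpow (norm_nonneg _) (by positivity)]
      congr 2
      ring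
    have hsum : Summable fun ι => ‖fourCoeff e (pD β f) (latPt e' ι)‖ :=
      Summable.of_nonneg_of_le (fun _ => norm_nonneg _) hterm (hS.mul_left (Q * C))
    calc ‖pD β f x‖ ≤ ∑' ι, ‖fourCoeff e (pD β f) (latPt e' ι)‖ :=
          norm_le_tsum_fourCoeff e e' he hdual _ (contDiff_pdSeq _ hf).continuous
            (pdSeq_periodic _ hper) hsum x
      _ ≤ Q * C * S := by
          rw [hSdef, ← tsum_mul_left]
          exact hsum.tsum_le_tsum hterm (hS.mul_left (Q * C))
      _ ≤ C * (S + 1) * Q := by nlinarith [mul_nonneg hQ0 hC.le]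
      _ = _ := by rw [hQ]; ring

end
end

section
/- Let d ≥ 1, E ⊆ ℝ^d be a non-degenerate parallelepiped and let f be a smooth E-periodic function on ℝ^d. Then the following are equivalent: (i) there exist constants C, h > 0 such that ‖∂^β f‖_{L^∞(ℝ^d)} ≤ C h^{|β|} for every multi-index β; (ii) f is a trigonometric polynomial, i.e. there is a finite set F ⊆ Λ'_E and coefficients c(α) ∈ ℂ (α ∈ F) with f(x) = Σ_{α∈F} c(α) e^{i⟨x,α⟩} for all x ∈ ℝ^d. -/
open MeasureTheory Filter
open scoped BigOperators InnerProductSpace Topology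

noncomputable section

/-- Periodicity with respect to the lattice generated by `e`. -/
def LatticePeriodic {d : ℕ} (e : Fin d → Euc d) (F : Euc d → ℂ) : Prop :=
  ∀ (x : Euc d) (j : Fin d → ℤ), F (x + latPt e j) = F x

/-- The plane wave `x ↦ e^{i⟨x,α⟩}`. -/
def planeWave {d : ℕ} (α x : Euc d) : ℂ := Complex.exp (Complex.I * (⟪x, α⟫_ℝ : ℂ))

/-- The function on the torus `ℝ^d / ℤ^d` obtained from `F` in the coordinates given by `e`. -/
def torusLift {d : ℕ} (e : Fin d → Euc d) (F : Euc d → ℂ) (z : UnitAddTorus (Fin d)) : ℂ :=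
  F (∑ i, Quotient.out (z i) • e i)

/-- The mean over a period cell. -/
def torusMean {d : ℕ} (e : Fin d → Euc d) (F : Euc d → ℂ) : ℂ :=
  ∫ z, torusLift e F z
    ∂(Measure.pi fun _ : Fin d => (AddCircle.haarAddCircle : Measure UnitAddCircle))

section PlaneWave

variable {d : ℕ}

lemma hasFDerivAt_planeWave (α x : Euc d) :
    HasFDerivAt (planeWave α)
      ((planeWave α x * Complex.I) • (Complex.ofRealCLM.comp (innerSL ℝ α))) x := by
  have h1 : HasFDerivAt (fun x : Euc d => Complex.I * (⟪x, α⟫_ℝ : ℂ))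
      (Complex.I • (Complex.ofRealCLM.comp (innerSL ℝ α))) x := by
    have := (Complex.ofRealCLM.comp (innerSL ℝ α)).hasFDerivAt (x := x)
    have := this.const_mul Complex.I
    simpa [real_inner_comm] using this
  have := h1.cexp
  rwa [smul_smul] at this

lemma fderiv_planeWave_apply (α x v : Euc d) :
    fderiv ℝ (planeWave α) x v = Complex.I * (⟪v, α⟫_ℝ : ℂ) * planeWave α x := by
  rw [(hasFDerivAt_planeWave α x).fderiv]
  simp [real_inner_comm]
  ring

lemma contDiff_planeWave (α : Euc d) : ContDiff ℝ (⊤ : ℕ∞) (planeWave α) := by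
  unfold planeWave
  exact (contDiff_const.mul (Complex.ofRealCLM.contDiff.comp
    (contDiff_id.inner ℝ contDiff_const))).cexp

lemma norm_planeWave (α x : Euc d) : ‖planeWave α x‖ = 1 := by
  rw [planeWave, mul_comm, Complex.norm_exp_ofReal_mul_I]

lemma planeWave_add (α x y : Euc d) : planeWave α (x + y) = planeWave α x * planeWave α y := by
  simp only [planeWave, inner_add_left, Complex.ofReal_add, mul_add, Complex.exp_add]

/-- The symbol of the constant-coefficient operator `pdSeq L` at the frequency `α`. -/
def pdSymbol (L : List (Fin d)) (α : Euc d) : ℂ :=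
  (L.map fun k => Complex.I * (α k : ℂ)).prod

lemma norm_pdSymbol_le (L : List (Fin d)) (α : Euc d) : ‖pdSymbol L α‖ ≤ ‖α‖ ^ L.length := by
  induction L with
  | nil => simp [pdSymbol]
  | cons k L ih =>
    have hk : ‖α k‖ ≤ ‖α‖ := PiLp.norm_apply_le α k
    simp only [pdSymbol, List.map_cons, List.prod_cons, List.length_cons, pow_succ'] at ih ⊢
    rw [norm_mul]
    gcongr
    simpa using hk

lemma pdSeq_sum_planeWave {ι : Type*} (F : Finset ι) (α : ι → Euc d) (L : List (Fin d))
    (c : ι → ℂ) :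
    pdSeq L (fun x => ∑ i ∈ F, c i * planeWave (α i) x) =
      fun x => ∑ i ∈ F, c i * pdSymbol L (α i) * planeWave (α i) x := by
  induction L generalizing c with
  | nil => simp [pdSeq, pdSymbol]
  | cons k L ih =>
    have hd : ∀ x, fderiv ℝ (fun x => ∑ i ∈ F, c i * planeWave (α i) x) x
        (EuclideanSpace.single k 1) =
        ∑ i ∈ F, (c i * (Complex.I * (α i k : ℂ))) * planeWave (α i) x := by
      intro x
      have h := HasFDerivAt.fun_sum (u := F)
        fun i _ => (hasFDerivAt_planeWave (α i) x).const_mul (c i)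
      rw [h.fderiv]
      simp only [_root_.sum_apply]
      refine Finset.sum_congr rfl fun i _ => ?_
      simp [EuclideanSpace.inner_single_right]
      ring
    simp only [pdSeq, hd]
    rw [ih]
    funext x
    refine Finset.sum_congr rfl fun i _ => ?_
    simp only [pdSymbol, List.map_cons, List.prod_cons]
    ring

lemma length_mIdxL (β : Fin d → ℕ) : (mIdxL β).length = ∑ i, β i := by
  simp [mIdxL, List.length_flatMap, Fin.sum_univ_def]

lemma pdSymbol_mIdxL_single (k : Fin d) (M : ℕ) (α : Euc d) :
    pdSymbol (mIdxL (Pi.single k M)) α = (Complex.I * (α k : ℂ)) ^ M := by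
  have h : ∀ β : Fin d → ℕ, pdSymbol (mIdxL β) α = ∏ i, (Complex.I * (α i : ℂ)) ^ β i := by
    intro β
    simp only [pdSymbol, mIdxL, List.map_flatMap, List.map_replicate, Fin.prod_univ_def]
    induction List.finRange d with
    | nil => simp
    | cons a l ih => simp [ih]
  rw [h, Finset.prod_eq_single k]
  · simp
  · intro b _ hb
    simp [hb]
  · simp

end PlaneWave

section Lattice

variable {d : ℕ} {e e' : Fin d → Euc d}

lemma LatticePeriodic.mul {F G : Euc d → ℂ} (hF : LatticePeriodic e F)
    (hG : LatticePeriodic e G) : LatticePeriodic e (fun x => F x * G x) :=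
  fun x j => by simp only [hF x j, hG x j]

lemma LatticePeriodic.fderiv_apply {F : Euc d → ℂ} (hF : LatticePeriodic e F) (v : Euc d) :
    LatticePeriodic e (fun x => fderiv ℝ F x v) := by
  intro x j
  have : (fun y => F (y + latPt e j)) = F := funext fun y => hF y j
  simp only [← fderiv_comp_add_right, this]

lemma inner_sum_smul_latPt
    (hdual : ∀ j k, ⟪e j, e' k⟫_ℝ = if j = k then 2 * Real.pi else 0)
    (t : Fin d → ℝ) (n : Fin d → ℤ) :
    ⟪∑ i, t i • e i, latPt e' n⟫_ℝ = 2 * Real.pi * ∑ i, n i * t i := by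
  simp only [latPt, sum_inner, inner_sum, real_inner_smul_left, real_inner_smul_right, hdual]
  simp only [mul_ite, mul_zero, Finset.sum_ite_eq', Finset.mem_univ, if_true, Finset.mul_sum]
  refine Finset.sum_congr rfl fun i _ => ?_
  ring

lemma latPt_neg (n : Fin d → ℤ) : latPt e (-n) = -latPt e n := by
  simp [latPt]

lemma planeWave_eq_mFourier
    (hdual : ∀ j k, ⟪e j, e' k⟫_ℝ = if j = k then 2 * Real.pi else 0)
    (t : Fin d → ℝ) (n : Fin d → ℤ) :
    planeWave (latPt e' n) (∑ i, t i • e i) =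
      UnitAddTorus.mFourier n (fun i => (t i : UnitAddCircle)) := by
  rw [planeWave, inner_sum_smul_latPt hdual]
  simp only [UnitAddTorus.mFourier, ContinuousMap.coe_mk, fourier_coe_apply, ← Complex.exp_sum]
  congr 1
  push_cast
  simp only [Finset.mul_sum]
  refine Finset.sum_congr rfl fun i _ => ?_
  ring

lemma latticePeriodic_planeWave
    (hdual : ∀ j k, ⟪e j, e' k⟫_ℝ = if j = k then 2 * Real.pi else 0) (n : Fin d → ℤ) :
    LatticePeriodic e (planeWave (latPt e' n)) := by
  intro x j
  have h : planeWave (latPt e' n) (latPt e j) = 1 := by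
    rw [planeWave, latPt, inner_sum_smul_latPt hdual, Complex.exp_eq_one_iff]
    refine ⟨∑ i, n i * j i, ?_⟩
    push_cast
    ring
  rw [planeWave_add, h, mul_one]

/-- Only finitely many dual lattice points lie in a given ball. -/
lemma finite_setOf_norm_latPt_le
    (hdual : ∀ j k, ⟪e j, e' k⟫_ℝ = if j = k then 2 * Real.pi else 0) (R : ℝ) :
    {n : Fin d → ℤ | ‖latPt e' n‖ ≤ R}.Finite := by
  have hfin : (Set.univ.pi fun i : Fin d =>
      Set.Icc (-⌈‖e i‖ * R⌉) ⌈‖e i‖ * R⌉).Finite :=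
    Set.Finite.pi fun i => Set.finite_Icc _ _
  refine hfin.subset fun n hn i _ => ?_
  have h1 : ⟪e i, latPt e' n⟫_ℝ = 2 * Real.pi * n i := by
    simpa [Pi.single_apply, ite_smul] using inner_sum_smul_latPt hdual (Pi.single i 1) n
  have h2 := abs_real_inner_le_norm (e i) (latPt e' n)
  rw [h1, abs_mul, abs_of_pos (by positivity)] at h2
  have h3 : |(n i : ℝ)| ≤ ‖e i‖ * R := by
    have : ‖e i‖ * ‖latPt e' n‖ ≤ ‖e i‖ * R := by gcongr; exact hn
    nlinarith [Real.pi_gt_three, abs_nonneg (n i : ℝ)]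
  have h4 : |(n i : ℝ)| ≤ (⌈‖e i‖ * R⌉ : ℝ) := h3.trans (Int.le_ceil _)
  rw [← Int.cast_abs, Int.cast_le, abs_le] at h4
  exact h4

lemma torusLift_coe {F : Euc d → ℂ} (hF : LatticePeriodic e F) (t : Fin d → ℝ) :
    torusLift e F (fun i => (t i : UnitAddCircle)) = F (∑ i, t i • e i) := by
  have h : ∀ i, ∃ n : ℤ, Quotient.out (t i : UnitAddCircle) = t i + n := by
    intro i
    have h1 : ((Quotient.out (t i : UnitAddCircle) : ℝ) : UnitAddCircle) = t i :=
      QuotientAddGroup.out_eq' _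
    have h2 := QuotientAddGroup.eq.1 h1.symm
    obtain ⟨n, hn⟩ := AddSubgroup.mem_zmultiples_iff.1 h2
    exact ⟨n, by simp at hn; linarith⟩
  choose n hn using h
  rw [torusLift, ← hF (∑ i, t i • e i) n, latPt, ← Finset.sum_add_distrib]
  simp only [hn, add_smul]

lemma isOpenQuotientMap_torus_mk :
    IsOpenQuotientMap (fun (t : Fin d → ℝ) (i : Fin d) => (t i : UnitAddCircle)) :=
  IsOpenQuotientMap.piMap (f := fun _ : Fin d => ((↑) : ℝ → UnitAddCircle))
    fun _ => QuotientAddGroup.isOpenQuotientMap_mk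

lemma continuous_torusLift {F : Euc d → ℂ} (hF : LatticePeriodic e F) (hc : Continuous F) :
    Continuous (torusLift e F) := by
  refine isOpenQuotientMap_torus_mk.isQuotientMap.continuous_iff.2 ?_
  have : torusLift e F ∘ (fun (t : Fin d → ℝ) (i : Fin d) => (t i : UnitAddCircle)) =
      fun t => F (∑ i, t i • e i) := funext fun t => torusLift_coe hF t
  rw [this]
  fun_prop

lemma exists_sum_smul_eq (he : LinearIndependent ℝ e) (x : Euc d) :
    ∃ t : Fin d → ℝ, ∑ i, t i • e i = x := by
  have h := he.span_eq_top_of_card_eq_finrank' (by simp)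
  exact (Submodule.mem_span_range_iff_exists_fun ℝ).1 (h ▸ Submodule.mem_top)

lemma norm_torusMean_le {F : Euc d → ℂ} {C : ℝ} (h : ∀ x, ‖F x‖ ≤ C) :
    ‖torusMean e F‖ ≤ C := by
  simpa [torusMean, torusLift] using norm_integral_le_of_norm_le_const
    (μ := Measure.pi fun _ : Fin d => (AddCircle.haarAddCircle : Measure UnitAddCircle))
    (Eventually.of_forall fun z => h (∑ i, Quotient.out (z i) • e i))

lemma torusMean_fderiv_eq_zero (he : LinearIndependent ℝ e) {F : Euc d → ℂ}
    (hF : LatticePeriodic e F) (hc : ContDiff ℝ (⊤ : ℕ∞) F) (v : Euc d) :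
    torusMean e (fun x => fderiv ℝ F x v) = 0 := by
  obtain ⟨w, rfl⟩ := exists_sum_smul_eq he v
  set v := ∑ i, w i • e i with hv
  set μ := Measure.pi fun _ : Fin d => (AddCircle.haarAddCircle : Measure UnitAddCircle)
  set shift : ℝ → UnitAddTorus (Fin d) := fun s i => ((s * w i : ℝ) : UnitAddCircle)
  have hF' := hF.fderiv_apply v
  have hG : Continuous (torusLift e F) := continuous_torusLift hF hc.continuous
  have hG' : Continuous (torusLift e fun x => fderiv ℝ F x v) :=
    continuous_torusLift hF' ((hc.continuous_fderiv (by simp)).clm_apply continuous_const)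
  obtain ⟨C, hC⟩ : ∃ C, ∀ z, ‖torusLift e (fun x => fderiv ℝ F x v) z‖ ≤ C := by
    obtain ⟨C, hC⟩ := isCompact_univ.exists_bound_of_continuousOn hG'.continuousOn
    exact ⟨C, fun z => hC z (Set.mem_univ z)⟩
  have hshift : ∀ {H : Euc d → ℂ}, LatticePeriodic e H → ∀ (t : Fin d → ℝ) (s : ℝ),
      torusLift e H ((fun i => (t i : UnitAddCircle)) + shift s) =
        H (∑ i, t i • e i + s • v) := by
    intro H hH t s
    have : (fun i => (t i : UnitAddCircle)) + shift s =
        fun i => ((t i + s * w i : ℝ) : UnitAddCircle) := by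
      funext i; simp [shift]
    rw [this, torusLift_coe hH, hv, Finset.smul_sum, ← Finset.sum_add_distrib]
    simp only [add_smul, mul_smul]
  have key := (hasDerivAt_integral_of_dominated_loc_of_deriv_le (μ := μ) (𝕜 := ℝ)
    (F := fun s z => torusLift e F (z + shift s))
    (F' := fun s z => torusLift e (fun x => fderiv ℝ F x v) (z + shift s))
    (x₀ := 0) (s := Set.univ) (bound := fun _ => C) univ_mem
    (Eventually.of_forall fun s => by
      exact (hG.comp (continuous_add_const (shift s))).aestronglyMeasurable)
    ((hG.comp (continuous_add_const (shift 0))).integrable_of_hasCompactSupport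
      (HasCompactSupport.of_compactSpace _))
    (hG'.comp (continuous_add_const (shift 0))).aestronglyMeasurable
    (Eventually.of_forall fun z s _ => hC _)
    (integrable_const C)
    (Eventually.of_forall fun z s _ => by
      obtain ⟨t, rfl⟩ := isOpenQuotientMap_torus_mk.surjective z
      simp only [hshift hF, hshift hF']
      have h1 : HasDerivAt (fun s : ℝ => ∑ i, t i • e i + s • v) v s := by
        simpa using ((hasDerivAt_id s).smul_const v).const_add (∑ i, t i • e i)
      exact ((hc.differentiable (by simp)) _).hasFDerivAt.comp_hasDerivAt s h1)).2
  simp only [integral_add_right_eq_self (μ := μ) (torusLift e F)] at key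
  have h0 : shift 0 = 0 := by funext i; simp [shift]
  simp only [h0, add_zero] at key
  exact key.unique (hasDerivAt_const _ _)

lemma integrable_torusLift {F : Euc d → ℂ} (hF : LatticePeriodic e F) (hc : Continuous F) :
    Integrable (torusLift e F)
      (Measure.pi fun _ : Fin d => (AddCircle.haarAddCircle : Measure UnitAddCircle)) :=
  (continuous_torusLift hF hc).integrable_of_hasCompactSupport
    (HasCompactSupport.of_compactSpace _)

lemma torusMean_fderiv_mul_planeWave (he : LinearIndependent ℝ e)
    {F : Euc d → ℂ} (hF : LatticePeriodic e F) (hc : ContDiff ℝ (⊤ : ℕ∞) F)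
    {α : Euc d} (hα : LatticePeriodic e (planeWave (-α))) (k : Fin d) :
    torusMean e (fun x => fderiv ℝ F x (EuclideanSpace.single k 1) * planeWave (-α) x) =
      Complex.I * (α k : ℂ) * torusMean e (fun x => F x * planeWave (-α) x) := by
  set v : Euc d := EuclideanSpace.single k 1
  have hw := contDiff_planeWave (-α)
  have hprod : (fun x => fderiv ℝ (fun x => F x * planeWave (-α) x) x v) =
      fun x => fderiv ℝ F x v * planeWave (-α) x -
        Complex.I * (α k : ℂ) * (F x * planeWave (-α) x) := by
    funext x
    rw [fderiv_fun_mul (hc.differentiable (by simp) x) (hw.differentiable (by simp) x)]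
    simp [fderiv_planeWave_apply, v, EuclideanSpace.inner_single_left]
    ring
  have h0 := torusMean_fderiv_eq_zero he (hF.mul hα) (hc.mul hw) v
  rw [hprod] at h0
  have hc' : Continuous fun x => fderiv ℝ F x v :=
    (hc.continuous_fderiv (by simp)).clm_apply continuous_const
  have hi1 := integrable_torusLift ((hF.fderiv_apply v).mul hα) (hc'.mul hw.continuous)
  have hi2 := integrable_torusLift (hF.mul hα) (hc.continuous.mul hw.continuous)
  have h2 := integral_sub hi1 (hi2.const_mul (Complex.I * (α k : ℂ)))
  rw [integral_const_mul] at h2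
  exact sub_eq_zero.1 (h2.symm.trans h0)

lemma torusMean_pdSeq_mul_planeWave (he : LinearIndependent ℝ e) {α : Euc d}
    (hα : LatticePeriodic e (planeWave (-α))) (L : List (Fin d))
    {F : Euc d → ℂ} (hF : LatticePeriodic e F) (hc : ContDiff ℝ (⊤ : ℕ∞) F) :
    torusMean e (fun x => pdSeq L F x * planeWave (-α) x) =
      pdSymbol L α * torusMean e (fun x => F x * planeWave (-α) x) := by
  induction L generalizing F with
  | nil => simp [pdSeq, pdSymbol]
  | cons k L ih =>
    simp only [pdSeq]
    rw [ih (hF.fderiv_apply _) ((hc.fderiv_right (by simp)).clm_apply contDiff_const),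
      torusMean_fderiv_mul_planeWave he hF hc hα]
    simp only [pdSymbol, List.map_cons, List.prod_cons]
    ring

lemma mFourierCoeff_torusLift
    (hdual : ∀ j k, ⟪e j, e' k⟫_ℝ = if j = k then 2 * Real.pi else 0)
    {F : Euc d → ℂ} (hF : LatticePeriodic e F) (n : Fin d → ℤ) :
    UnitAddTorus.mFourierCoeff (torusLift e F) n =
      torusMean e (fun x => F x * planeWave (-latPt e' n) x) := by
  refine integral_congr_ae (Eventually.of_forall fun z => ?_)
  obtain ⟨t, rfl⟩ := isOpenQuotientMap_torus_mk.surjective z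
  have hw := latticePeriodic_planeWave hdual (-n)
  rw [← latPt_neg]
  simp only [torusLift_coe hF, torusLift_coe (hF.mul hw), planeWave_eq_mFourier hdual,
    smul_eq_mul, mul_comm]

/-- A continuous periodic function whose Fourier coefficients vanish off a finite set of frequencies
is a trigonometric polynomial. -/
lemma eq_sum_planeWave_of_torusMean_eq_zero (he : LinearIndependent ℝ e)
    (hdual : ∀ j k, ⟪e j, e' k⟫_ℝ = if j = k then 2 * Real.pi else 0)
    {F : Euc d → ℂ} (hF : LatticePeriodic e F) (hc : Continuous F) (S : Finset (Fin d → ℤ))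
    (hS : ∀ n ∉ S, torusMean e (fun x => F x * planeWave (-latPt e' n) x) = 0) (x : Euc d) :
    F x = ∑ n ∈ S, torusMean e (fun x => F x * planeWave (-latPt e' n) x) *
      planeWave (latPt e' n) x := by
  simp only [← mFourierCoeff_torusLift hdual hF] at hS ⊢
  obtain ⟨t, rfl⟩ := exists_sum_smul_eq he x
  have h := UnitAddTorus.hasSum_mFourier_series_apply_of_summable
    (f := ⟨torusLift e F, continuous_torusLift hF hc⟩)
    (summable_of_ne_finset_zero (s := S) hS) (fun i => (t i : UnitAddCircle))
  have h' := hasSum_sum_of_ne_finset_zero (s := S) (L := .unconditional _)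
    (f := fun n => UnitAddTorus.mFourierCoeff (torusLift e F) n •
      UnitAddTorus.mFourier n (fun i => (t i : UnitAddCircle)))
    fun n hn => by rw [hS n hn, zero_smul]
  have := h.unique h'
  simpa only [ContinuousMap.coe_mk, torusLift_coe hF, smul_eq_mul,
    planeWave_eq_mFourier hdual] using this

lemma torusMean_mul_planeWave_eq_zero (he : LinearIndependent ℝ e)
    {F : Euc d → ℂ} (hF : LatticePeriodic e F) (hc : ContDiff ℝ (⊤ : ℕ∞) F) {C h : ℝ}
    (hh : 0 < h) (hb : ∀ (β : Fin d → ℕ) (x : Euc d), ‖pD β F x‖ ≤ C * h ^ (∑ i, β i))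
    {α : Euc d} (hα : LatticePeriodic e (planeWave (-α))) {k : Fin d} (hk : h < |α k|) :
    torusMean e (fun x => F x * planeWave (-α) x) = 0 := by
  set a := torusMean e (fun x => F x * planeWave (-α) x)
  have hle : ∀ M : ℕ, ‖a‖ ≤ C * (h / |α k|) ^ M := by
    intro M
    have h1 : ‖torusMean e (fun x => pdSeq (mIdxL (Pi.single k M)) F x * planeWave (-α) x)‖ ≤
        C * h ^ M := by
      refine norm_torusMean_le fun x => ?_
      rw [norm_mul, norm_planeWave, mul_one]
      simpa [pD] using hb (Pi.single k M) x
    rw [torusMean_pdSeq_mul_planeWave he hα _ hF hc, pdSymbol_mIdxL_single, norm_mul, norm_pow,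
      norm_mul, Complex.norm_I, one_mul, Complex.norm_real, Real.norm_eq_abs] at h1
    have hpos : 0 < |α k| := hh.trans hk
    rw [div_pow, ← mul_div_assoc, le_div_iff₀ (pow_pos hpos M), mul_comm]
    exact h1
  have hlim : Tendsto (fun M : ℕ => C * (h / |α k|) ^ M) atTop (𝓝 (C * 0)) :=
    (tendsto_pow_atTop_nhds_zero_of_lt_one (by positivity)
      ((div_lt_one (hh.trans hk)).2 hk)).const_mul C
  rw [mul_zero] at hlim
  exact norm_le_zero_iff.1 (ge_of_tendsto' hlim hle)

end Lattice

/-- A smooth `E`-periodic function has all its partial derivatives bounded by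
`C h^{|β|}` iff it is a trigonometric polynomial with frequencies in the dual lattice. -/
theorem periodic_gevrey_zero_iff_trigonometric_polynomial
    {d : ℕ} (hd : 1 ≤ d)
    (e e' : Fin d → Euc d) (he : LinearIndependent ℝ e)
    (hdual : ∀ j k, ⟪e j, e' k⟫_ℝ = if j = k then 2 * Real.pi else 0)
    (f : Euc d → ℂ) (hf : ContDiff ℝ (⊤ : ℕ∞) f)
    (hper : ∀ (x : Euc d) (j : Fin d → ℤ), f (x + latPt e j) = f x) :
    (∃ C h : ℝ, 0 < C ∧ 0 < h ∧ ∀ (β : Fin d → ℕ) (x : Euc d),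
        ‖pD β f x‖ ≤ C * h ^ (∑ i, β i))
    ↔
    (∃ (F : Finset (Fin d → ℤ)) (c : (Fin d → ℤ) → ℂ), ∀ x : Euc d,
        f x = ∑ ι ∈ F, c ι * Complex.exp (Complex.I * (⟪x, latPt e' ι⟫_ℝ : ℂ))) := by
  constructor
  · rintro ⟨C, h, -, hh, hb⟩
    have hfin : {n : Fin d → ℤ | ∀ k, |latPt e' n k| ≤ h}.Finite := by
      refine (finite_setOf_norm_latPt_le hdual (Real.sqrt (∑ _k : Fin d, h ^ 2))).subset
        fun n hn => ?_
      rw [Set.mem_ofPred_eq, EuclideanSpace.norm_eq]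
      refine Real.sqrt_le_sqrt (Finset.sum_le_sum fun k _ => ?_)
      have := hn k
      rw [Real.norm_eq_abs]
      gcongr
    refine ⟨hfin.toFinset, _, eq_sum_planeWave_of_torusMean_eq_zero he hdual hper
      hf.continuous _ fun n hn => ?_⟩
    rw [Set.Finite.mem_toFinset, Set.mem_ofPred_eq] at hn
    push Not at hn
    obtain ⟨k, hk⟩ := hn
    have hα := latticePeriodic_planeWave hdual (-n)
    rw [latPt_neg] at hα
    exact torusMean_mul_planeWave_eq_zero he hper hf hh hb hα hk
  · rintro ⟨F, c, hfc⟩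
    obtain rfl : f = fun x => ∑ n ∈ F, c n * planeWave (latPt e' n) x := funext hfc
    refine ⟨∑ n ∈ F, ‖c n‖ + 1, ∑ n ∈ F, ‖latPt e' n‖ + 1, by positivity, by positivity,
      fun β x => ?_⟩
    rw [pD, pdSeq_sum_planeWave, add_mul, Finset.sum_mul]
    refine (norm_sum_le _ _).trans (le_add_of_le_of_nonneg (Finset.sum_le_sum fun n hn => ?_)
      (by positivity))
    rw [norm_mul, norm_mul, norm_planeWave, mul_one, ← length_mIdxL]
    gcongr
    refine (norm_pdSymbol_le _ _).trans ?_
    gcongr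
    have := Finset.single_le_sum (f := fun n => ‖latPt e' n‖) (fun _ _ => norm_nonneg _) hn
    linarith

end
end
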